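/- Let X ⊆ I₂ be a set of permutations, let α, β ∈ I₂ with α 2-rigid, suppose α ⊕ β ∈ I₂ ∩ Av(X), and suppose that C = I₂ ∩ Av(X) ∩ Av(α ⊕ β) is an infinite class. Then C and C' = I₂ ∩ Av(X) ∩ Av(α ⊕ 1 ⊕ β) have the same growth rate: s(C) = s(C'). -/

import Mathlib

open Filter

/-- `f` is an embedding (involvement) of the permutation `α` into the permutation `π`:
it is strictly monotone on positions and preserves the relative order of values. -/
def IsEmbedding {m n : ℕ} (α : Equiv.Perm (Fin m)) (π : Equiv.Perm (Fin n))
    (f : Fin m → Fin n) : Prop :=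
  StrictMono f ∧ ∀ a b : Fin m, α a < α b ↔ π (f a) < π (f b)

/-- A permutation of arbitrary (finite) length. -/
abbrev PermSig := Σ n : ℕ, Equiv.Perm (Fin n)

/-- `α ≼ π`: the pattern `α` is involved in `π`. -/
def Involves (α π : PermSig) : Prop := ∃ f, IsEmbedding α.2 π.2 f

/-- The class of permutations avoiding every pattern in `X`. -/
def AvClass (X : Set PermSig) : Set PermSig := {π | ∀ α ∈ X, ¬ Involves α π}

/-- A pattern class: a set of permutations closed downward under involvement. -/
def IsPatternClass (C : Set PermSig) : Prop :=
  ∀ α π : PermSig, Involves α π → π ∈ C → α ∈ C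

/-- The number of permutations of length `n` in `C`. -/
noncomputable def classCount (C : Set PermSig) (n : ℕ) : ℕ :=
  Nat.card {π : Equiv.Perm (Fin n) // (⟨n, π⟩ : PermSig) ∈ C}

/-- The (upper) growth rate `s(C) = limsup |C ∩ S_n|^{1/n}`, valued in `ℝ≥0∞`. -/
noncomputable def growthRate (C : Set PermSig) : ENNReal :=
  Filter.atTop.limsup fun n : ℕ => (classCount C n : ENNReal) ^ (1 / (n : ℝ))

/-- `π` contains a decreasing subsequence of length `k`. -/
def HasDecSeq {n : ℕ} (π : Equiv.Perm (Fin n)) (k : ℕ) : Prop :=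
  ∃ q : Fin k → Fin n, StrictMono q ∧ StrictAnti fun i => π (q i)

/-- The class `I_k = Av(δ_{k+1})` of permutations with no decreasing
subsequence of length `k+1`. -/
def IkClass (k : ℕ) : Set PermSig := {π | ¬ HasDecSeq π.2 (k + 1)}

/-- `f` and `g` witness `π` as a merge of `α` and `β`: both are embeddings and
their ranges partition the points of `π`. -/
def IsMergeVia {a b n : ℕ} (α : Equiv.Perm (Fin a)) (β : Equiv.Perm (Fin b))
    (π : Equiv.Perm (Fin n)) (f : Fin a → Fin n) (g : Fin b → Fin n) : Prop :=
  IsEmbedding α π f ∧ IsEmbedding β π g ∧ ∀ x : Fin n, (∃ i, f i = x) ↔ ¬∃ j, g j = x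

/-- The merge `M(C, D)` of two sets of permutations. -/
def MergeClass (C D : Set PermSig) : Set PermSig :=
  {π | ∃ α ∈ C, ∃ β ∈ D, ∃ f g, IsMergeVia α.2 β.2 π.2 f g}

/-- Number of indices `c` with `c+1 < n` such that exactly one of the points
`c`, `c+1` lies in `S`. -/
noncomputable def posChanges {n : ℕ} (S : Set (Fin n)) : ℕ :=
  Set.ncard {c : Fin n | ∃ h : (c : ℕ) + 1 < n, ¬ (c ∈ S ↔ (⟨(c : ℕ) + 1, h⟩ : Fin n) ∈ S)}

/-- Total number of type changes, by position and by value, of the merge of `π`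
whose first part occupies the set of positions `S`. -/
noncomputable def typeChanges {n : ℕ} (π : Equiv.Perm (Fin n)) (S : Set (Fin n)) : ℕ :=
  posChanges S + posChanges ((fun x => π x) '' S)

/-- The `B`-bounded merge `M_B(C, D)`: merges of a member of `C` with a member of
`D` having at most `B` type changes in total, by position or by value. -/
def BMergeClass (B : ℕ) (C D : Set PermSig) : Set PermSig :=
  {π | ∃ α ∈ C, ∃ β ∈ D, ∃ f g, IsMergeVia α.2 β.2 π.2 f g ∧
    typeChanges π.2 (Set.range f) ≤ B}

/-- The direct sum of two permutations. -/
def dsum {a b : ℕ} (α : Equiv.Perm (Fin a)) (β : Equiv.Perm (Fin b)) :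
    Equiv.Perm (Fin (a + b)) :=
  finSumFinEquiv.symm.trans ((Equiv.sumCongr α β).trans finSumFinEquiv)

/-- The direct sum `α ⊕ β` of two permutations of arbitrary lengths. -/
def DSum (α β : PermSig) : PermSig := ⟨α.1 + β.1, dsum α.2 β.2⟩

/-- The increasing permutation `ι_m` of length `m`. -/
def iotaSig (m : ℕ) : PermSig := ⟨m, 1⟩

/-- The direct sum of a list of permutations. -/
def DSumList (l : List PermSig) : PermSig := l.foldr DSum (iotaSig 0)

/-- A (nonempty) permutation that is not the direct sum of two nonempty permutations. -/
def PlusIndec (ρ : PermSig) : Prop :=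
  ρ.1 ≠ 0 ∧ ∀ α β : PermSig, α.1 ≠ 0 → β.1 ≠ 0 → ρ ≠ DSum α β

/-- `ρ = red(π)`: writing `π = ι_{m₀} ⊕ ρ₁ ⊕ ι_{m₁} ⊕ ⋯ ⊕ ρ_c ⊕ ι_{m_c}` with each
`ρ_i` plus indecomposable of length at least 2, the rigid reduction of `π` is
`ρ = ρ₁ ⊕ ⋯ ⊕ ρ_c`. -/
def IsRigidReductionOf (ρ π : PermSig) : Prop :=
  ∃ (m₀ : ℕ) (pairs : List (PermSig × ℕ)),
    (∀ p ∈ pairs, PlusIndec p.1 ∧ 2 ≤ p.1.1) ∧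
    π = DSum (iotaSig m₀) (DSumList (pairs.map fun p => DSum p.1 (iotaSig p.2))) ∧
    ρ = DSumList (pairs.map Prod.fst)


/-- `π` is `k`-rigid: every element belongs to a subset whose pattern is `δ_k`. -/
def KRigid {n : ℕ} (k : ℕ) (π : Equiv.Perm (Fin n)) : Prop :=
  ∀ p : Fin n, ∃ q : Fin k → Fin n, StrictMono q ∧
    (StrictAnti fun i => π (q i)) ∧ ∃ i, q i = p

/-! ### Counting -/

/-- Pattern of `π` on the positions in `s`. -/
noncomputable def pat {n : ℕ} (π : Equiv.Perm (Fin n)) (s : Finset (Fin n)) :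
    Equiv.Perm (Fin s.card) :=
  (s.orderIsoOfFin rfl).toEquiv.trans
    ((π.subtypeEquiv (p := fun x => x ∈ s) (q := fun x => x ∈ s.map π.toEmbedding)
      (by intro a; simp)).trans
      ((s.map π.toEmbedding).orderIsoOfFin (Finset.card_map _)).symm.toEquiv)

theorem pat_spec {n : ℕ} (π : Equiv.Perm (Fin n)) (s T : Finset (Fin n))
    (hT : s.map π.toEmbedding = T) (hc : T.card = s.card) (a : Fin s.card) :
    π (s.orderEmbOfFin rfl a) = T.orderEmbOfFin hc (pat π s a) := by
  subst hT
  rw [← Finset.coe_orderIsoOfFin_apply, ← Finset.coe_orderIsoOfFin_apply]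
  simp [pat]

theorem pat_emb {n : ℕ} (π : Equiv.Perm (Fin n)) (s : Finset (Fin n)) :
    IsEmbedding (pat π s) π (s.orderEmbOfFin rfl) := by
  refine ⟨(s.orderEmbOfFin rfl).strictMono, fun a b => ?_⟩
  rw [pat_spec π s _ rfl (Finset.card_map _) a, pat_spec π s _ rfl (Finset.card_map _) b]
  simp

/-- `χ` is constant on the blocks determined by at most `B` cuts of the coordinate `v`. -/
def Blk {n : ℕ} {κ : Type*} (B : ℕ) (v : Fin n → ℕ) (χ : Fin n → κ) : Prop :=
  ∃ F : Finset ℕ, F.card ≤ B ∧ ∀ x y, (∀ c ∈ F, (v x < c ↔ v y < c)) → χ x = χ y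

/-- Block colorings. -/
def colMap (n B k : ℕ) (d : (Fin B → Fin (n + 1)) × ((Fin B → Bool) → Fin (k + 1))) :
    Fin n → Fin (k + 1) :=
  fun x => d.2 (fun i => decide ((x : ℕ) < (d.1 i : ℕ)))

theorem blk_mem {n B k : ℕ} (χ : Fin n → Fin (k + 1)) (h : Blk B (fun x => (x : ℕ)) χ) :
    ∃ d, colMap n B k d = χ := by
  classical
  obtain ⟨F, hF, h⟩ := h
  let c : Fin B → Fin (n + 1) := fun i => ⟨min n (F.toList.getD i 0), by omega⟩
  let sig : Fin n → Fin B → Bool := fun x i => decide ((x : ℕ) < (c i : ℕ))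
  let g : (Fin B → Bool) → Fin (k + 1) := fun s =>
    if h : ∃ x, sig x = s then χ h.choose else 0
  refine ⟨(c, g), funext fun x => ?_⟩
  have hx : ∃ y, sig y = sig x := ⟨x, rfl⟩
  have : colMap n B k (c, g) x = χ hx.choose := by
    change g (sig x) = _
    simp only [g]
    rw [dif_pos hx]
  rw [this]
  apply h
  intro e he
  have hs := hx.choose_spec
  set y := hx.choose
  rw [← Finset.mem_toList, List.mem_iff_getElem] at he
  obtain ⟨i, hi, rfl⟩ := he
  have hi' : i < B := by
    rw [Finset.length_toList] at hi; omega
  have h1 := congrFun hs ⟨i, hi'⟩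
  simp only [sig, c, decide_eq_decide] at h1
  rw [List.getD_eq_getElem _ _ hi] at h1
  have := x.2; have := y.2
  change (y : ℕ) < _ ↔ (x : ℕ) < _
  omega

theorem fiber_card (C : Set PermSig) {n k : ℕ} (χ χ' : Fin n → Fin (k + 1)) :
    Nat.card {π : Equiv.Perm (Fin n) // (∀ x, χ' (π x) = χ x) ∧
      ∀ i, (⟨_, pat π (Finset.univ.filter (χ · = i))⟩ : PermSig) ∈ C} ≤
    ∏ i : Fin (k + 1), classCount C (Finset.univ.filter (χ · = i)).card := by
  classical
  unfold classCount
  rw [← Nat.card_pi]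
  refine Nat.card_le_card_of_injective
    (fun π i => ⟨pat π.1 (Finset.univ.filter (χ · = i)), π.2.2 i⟩) ?_
  rintro ⟨π, h1, h2⟩ ⟨ρ, h3, h4⟩ h
  have key : ∀ (σ : Equiv.Perm (Fin n)), (∀ x, χ' (σ x) = χ x) → ∀ i,
      (Finset.univ.filter (χ · = i)).map σ.toEmbedding = Finset.univ.filter (χ' · = i) := by
    intro σ hσ i
    ext y
    simp only [Finset.mem_map, Finset.mem_filter, Finset.mem_univ, true_and]
    constructor
    · rintro ⟨x, hx, rfl⟩
      exact (hσ x).trans hx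
    · intro hy
      refine ⟨σ.symm y, ?_, by simp⟩
      rw [← hσ]; simpa using hy
  have : π = ρ := by
    ext1 x
    have hi := congrFun h (χ x)
    simp only [Subtype.mk.injEq] at hi
    have hmem : x ∈ Finset.univ.filter (χ · = χ x) := by simp
    have hr : x ∈ Set.range ((Finset.univ.filter (χ · = χ x)).orderEmbOfFin rfl) := by
      rw [Finset.range_orderEmbOfFin]; simp
    obtain ⟨a, ha⟩ := hr
    have hc : (Finset.univ.filter (χ' · = χ x)).card = (Finset.univ.filter (χ · = χ x)).card := by
      rw [← key π h1, Finset.card_map]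
    have e1 := pat_spec π _ _ (key π h1 (χ x)) hc a
    have e2 := pat_spec ρ _ _ (key ρ h3 (χ x)) hc a
    rw [ha] at e1 e2
    rw [e1, e2, hi]
  subst this; rfl

theorem count_le (C C' : Set PermSig) (k B : ℕ)
    (h : ∀ n (π : Equiv.Perm (Fin n)), (⟨n, π⟩ : PermSig) ∈ C' → ∃ χ : Fin n → Fin (k + 1),
      Blk B (fun x => (x : ℕ)) χ ∧ Blk B (fun x => (π x : ℕ)) χ ∧
      ∀ i, (⟨_, pat π (Finset.univ.filter (χ · = i))⟩ : PermSig) ∈ C)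
    (M t : NNReal) (hM : ∀ n, (classCount C n : NNReal) ≤ M * t ^ n) (n : ℕ) :
    (classCount C' n : NNReal) ≤
      (((n + 1) ^ B * (k + 1) ^ (2 ^ B)) ^ 2 : ℕ) * (M ^ (k + 1) * t ^ n) := by
  classical
  let D := (Fin B → Fin (n + 1)) × ((Fin B → Bool) → Fin (k + 1))
  have hD : Fintype.card (D × D) = ((n + 1) ^ B * (k + 1) ^ (2 ^ B)) ^ 2 := by
    simp [D, sq]
  let fib : D × D → Set (Equiv.Perm (Fin n)) := fun d =>
    {π | (∀ x, colMap n B k d.2 (π x) = colMap n B k d.1 x) ∧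
      ∀ i, (⟨_, pat π (Finset.univ.filter (colMap n B k d.1 · = i))⟩ : PermSig) ∈ C}
  have hsub : {π : Equiv.Perm (Fin n) | (⟨n, π⟩ : PermSig) ∈ C'} ⊆
      ⋃ d ∈ (Finset.univ : Finset (D × D)), fib d := by
    intro π hπ
    obtain ⟨χ, h1, h2, h3⟩ := h n π hπ
    obtain ⟨d1, rfl⟩ := blk_mem χ h1
    have : Blk B (fun x => (x : ℕ)) (colMap n B k d1 ∘ π.symm) := by
      obtain ⟨F, hF, hh⟩ := h2
      refine ⟨F, hF, fun x y hxy => hh _ _ ?_⟩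
      simpa using hxy
    obtain ⟨d2, hd2⟩ := blk_mem _ this
    simp only [Set.mem_iUnion]
    refine ⟨(d1, d2), Finset.mem_univ _, ?_, h3⟩
    intro x
    simp only [hd2]; simp
  have hfib : ∀ d, ((fib d).ncard : NNReal) ≤ M ^ (k + 1) * t ^ n := by
    intro d
    have h1 := fiber_card C (colMap n B k d.1) (colMap n B k d.2)
    have h2 : (fib d).ncard ≤ _ := h1
    calc ((fib d).ncard : NNReal) ≤ _ := Nat.cast_le.mpr h2
      _ ≤ ∏ i : Fin (k + 1), (M * t ^ (Finset.univ.filter (colMap n B k d.1 · = i)).card) := by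
        rw [Nat.cast_prod]
        exact Finset.prod_le_prod' fun i _ => hM _
      _ = M ^ (k + 1) * t ^ n := by
        rw [Finset.prod_mul_distrib, Finset.prod_pow_eq_pow_sum]
        congr 1
        · simp
        · congr 1
          rw [← Finset.card_eq_sum_card_fiberwise (fun x _ => Finset.mem_univ _)]
          simp
  have h0 : classCount C' n ≤ ∑ d : D × D, (fib d).ncard := by
    change ({π : Equiv.Perm (Fin n) | (⟨n, π⟩ : PermSig) ∈ C'} : Set _).ncard ≤ _
    refine (Set.ncard_le_ncard hsub (Set.toFinite _)).trans ?_
    exact Finset.set_ncard_biUnion_le _ _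
  calc (classCount C' n : NNReal) ≤ ((∑ d : D × D, (fib d).ncard : ℕ) : NNReal) := by
        exact_mod_cast h0
    _ ≤ ∑ d : D × D, (M ^ (k + 1) * t ^ n) := by
        rw [Nat.cast_sum]; exact Finset.sum_le_sum fun d _ => hfib d
    _ = _ := by rw [Finset.sum_const, Finset.card_univ, hD, nsmul_eq_mul]

theorem growth_mono {C C' : Set PermSig} (h : C ⊆ C') : growthRate C ≤ growthRate C' := by
  unfold growthRate
  refine limsup_le_limsup (Eventually.of_forall fun n => ?_)
  refine ENNReal.rpow_le_rpow ?_ (by positivity)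
  have : classCount C n ≤ classCount C' n :=
    Set.ncard_le_ncard (s := {π : Equiv.Perm (Fin n) | (⟨n, π⟩ : PermSig) ∈ C})
      (fun π hπ => h hπ) (Set.toFinite _)
  exact_mod_cast this

theorem growth_le_of_bounds (C C' : Set PermSig) (a D E : ℕ)
    (h : ∀ (M t : NNReal), (∀ n, (classCount C n : NNReal) ≤ M * t ^ n) →
      ∀ n : ℕ, (classCount C' n : NNReal) ≤ ((D * (n + 1) ^ a : ℕ) : NNReal) * (M ^ E * t ^ n)) :
    growthRate C' ≤ growthRate C := by
  refine le_of_forall_gt_imp_ge_of_dense fun u hu => ?_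
  obtain ⟨t2, h2, h2u⟩ := ENNReal.lt_iff_exists_nnreal_btwn.mp hu
  obtain ⟨t1, h1, h12⟩ := ENNReal.lt_iff_exists_nnreal_btwn.mp h2
  have h12' : t1 < t2 := by exact_mod_cast h12
  have ht1 : 0 < t1 := by
    have : (0 : ENNReal) < t1 := lt_of_le_of_lt zero_le h1
    exact_mod_cast this
  have ev := eventually_lt_of_limsup_lt h1
  obtain ⟨n0, hn0⟩ := eventually_atTop.mp ev
  have hbig : ∀ n, n0 ≤ n → 1 ≤ n → (classCount C n : NNReal) ≤ t1 ^ n := by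
    intro n hn hn1
    have := (hn0 n hn).le
    rw [one_div, ENNReal.rpow_inv_le_iff (by exact_mod_cast hn1), ENNReal.rpow_natCast] at this
    exact_mod_cast this
  obtain ⟨M, hM⟩ : ∃ M : NNReal, ∀ n, (classCount C n : NNReal) ≤ M * t1 ^ n := by
    refine ⟨1 + ∑ i ∈ Finset.range (n0 + 1), (classCount C i : NNReal) / t1 ^ i, fun n => ?_⟩
    by_cases hn : n < n0 + 1
    · have : (classCount C n : NNReal) / t1 ^ n ≤
          ∑ i ∈ Finset.range (n0 + 1), (classCount C i : NNReal) / t1 ^ i :=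
        Finset.single_le_sum (f := fun i => (classCount C i : NNReal) / t1 ^ i)
          (fun i _ => zero_le) (Finset.mem_range.mpr hn)
      rw [← div_le_iff₀ (by positivity)]
      exact this.trans le_add_self
    · refine (hbig n (by omega) (by omega)).trans ?_
      exact le_mul_of_one_le_left zero_le le_self_add
  have hc := h M t1 hM
  have hlim : Tendsto (fun n : ℕ => ((D : ℝ) * 2 ^ a * M ^ E) *
      ((n : ℝ) ^ a * ((t1 : ℝ) / t2) ^ n)) atTop (nhds (((D : ℝ) * 2 ^ a * M ^ E) * 0)) := by
    refine Tendsto.const_mul _ (tendsto_pow_const_mul_const_pow_of_abs_lt_one a ?_)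
    have : (t1 : ℝ) < t2 := by exact_mod_cast h12'
    have ht2 : (0 : ℝ) < t2 := lt_of_le_of_lt t1.2 this
    rw [abs_of_nonneg (by positivity), div_lt_one ht2]
    exact this
  rw [mul_zero] at hlim
  have ev2 := hlim.eventually (gt_mem_nhds one_pos)
  refine limsup_le_of_le (by isBoundedDefault) ?_
  filter_upwards [ev2, eventually_ge_atTop 1] with n hn hn1
  refine le_trans ?_ h2u.le
  rw [one_div, ENNReal.rpow_inv_le_iff (by exact_mod_cast hn1), ENNReal.rpow_natCast]
  have hfin : (classCount C' n : NNReal) ≤ t2 ^ n := by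
    refine (hc n).trans ?_
    rw [← NNReal.coe_le_coe]
    push_cast
    have ht2 : (0 : ℝ) < t2 := by
      have : (0 : NNReal) < t2 := ht1.trans h12'
      exact_mod_cast this
    have e : ((n : ℝ) + 1) ^ a ≤ 2 ^ a * (n : ℝ) ^ a := by
      rw [← mul_pow]
      have : (1 : ℝ) ≤ n := by exact_mod_cast hn1
      gcongr; linarith
    calc (D : ℝ) * ((n : ℝ) + 1) ^ a * (M ^ E * t1 ^ n)
        ≤ D * (2 ^ a * (n : ℝ) ^ a) * (M ^ E * t1 ^ n) := by gcongr
      _ = ((D : ℝ) * 2 ^ a * M ^ E) * ((n : ℝ) ^ a * ((t1 : ℝ) / t2) ^ n) * t2 ^ n := by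
        rw [div_pow]; field_simp
      _ ≤ 1 * t2 ^ n := by gcongr
      _ = t2 ^ n := one_mul _
  exact_mod_cast hfin

theorem growth_le_of_coloring (C C' : Set PermSig) (k B : ℕ)
    (h : ∀ n (π : Equiv.Perm (Fin n)), (⟨n, π⟩ : PermSig) ∈ C' → ∃ χ : Fin n → Fin (k + 1),
      Blk B (fun x => (x : ℕ)) χ ∧ Blk B (fun x => (π x : ℕ)) χ ∧
      ∀ i, (⟨_, pat π (Finset.univ.filter (χ · = i))⟩ : PermSig) ∈ C) :
    growthRate C' ≤ growthRate C := by
  refine growth_le_of_bounds C C' (B * 2) (((k + 1) ^ (2 ^ B)) ^ 2) (k + 1) fun M t hM n => ?_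
  refine (count_le C C' k B h M t hM n).trans (le_of_eq ?_)
  congr 2
  rw [mul_pow, ← pow_mul, mul_comm]
/-! ### Staircase representation of 321-avoiding permutations -/

theorem exists_times (low : ℕ → Prop) (J : ℕ → ℕ → Prop)
    (hanti : ∀ v w w', J v w → w' ≤ w → J v w')
    (hmono : ∀ v v' w, J v w → v < w → low v' → ¬ J v' w → v' < v) (k : ℕ) :
    ∃ t : ℕ → ℚ, (∀ v u, v < u → u < k → t v < t u) ∧
      (∀ v u, v < u → u < k → J v u → t u < t v + 1) ∧
      (∀ v u, v < u → u < k → low v → ¬ low u → ¬ J v u → t v + 1 < t u) := by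
  classical
  induction k with
  | zero => exact ⟨fun _ => 0, by simp, by simp, by simp⟩
  | succ k ih =>
    obtain ⟨t, h1, h2, h3⟩ := ih
    obtain ⟨q, hq1, hq2⟩ := Order.exists_between_finsets
      ((Finset.range k).image t ∪
        ((Finset.range k).filter (fun v => low v ∧ ¬ low k ∧ ¬ J v k)).image (fun v => t v + 1))
      (((Finset.range k).filter (fun v => J v k)).image (fun v => t v + 1)) (by
        intro x hx y hy
        simp only [Finset.mem_union, Finset.mem_image, Finset.mem_range, Finset.mem_filter] at hx hy
        obtain ⟨v, ⟨hv, hJ⟩, rfl⟩ := hy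
        rcases hx with ⟨v', hv', rfl⟩ | ⟨v', ⟨hv', hl, -, hn⟩, rfl⟩
        · rcases lt_trichotomy v v' with h | h | h
          · exact h2 v v' h hv' (hanti _ _ _ hJ hv'.le)
          · subst h; linarith
          · have := h1 v' v h hv; linarith
        · have := h1 v' v (hmono v v' k hJ hv hl hn) hv
          linarith)
    simp only [Finset.mem_union, Finset.mem_image, Finset.mem_range, Finset.mem_filter] at hq1 hq2
    refine ⟨fun v => if v = k then q else t v, ?_, ?_, ?_⟩
    · intro v u hvu hu
      have hvk : v ≠ k := by omega
      by_cases huk : u = k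
      · simp only [hvk, huk, if_true, if_false]
        exact hq1 _ (Or.inl ⟨v, by omega, rfl⟩)
      · simp only [hvk, huk, if_false]
        exact h1 v u hvu (by omega)
    · intro v u hvu hu hJ
      have hvk : v ≠ k := by omega
      by_cases huk : u = k
      · simp only [hvk, huk, if_true, if_false]
        subst huk
        exact hq2 _ ⟨v, ⟨by omega, hJ⟩, rfl⟩
      · simp only [hvk, huk, if_false]
        exact h2 v u hvu (by omega) hJ
    · intro v u hvu hu hlv hlu hJ
      have hvk : v ≠ k := by omega
      by_cases huk : u = k
      · simp only [hvk, huk, if_true, if_false]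
        subst huk
        exact hq1 _ (Or.inr ⟨v, ⟨by omega, hlv, hlu, hJ⟩, rfl⟩)
      · simp only [hvk, huk, if_false]
        exact h3 v u hvu (by omega) hlv hlu hJ

/-- Column of a level of the staircase. -/
def colz (l : ℤ) : ℤ := (l + 1) / 2
/-- Row of a level of the staircase. -/
def rowz (l : ℤ) : ℤ := l / 2

/-- Lexicographic comparison of the coordinates of two points. -/
def LexLt (c : ℤ) (t : ℕ) (c' : ℤ) (t' : ℕ) : Prop := c < c' ∨ (c = c' ∧ t < t')

/-- Staircase representation: level and time of each point. -/
def StairRep {n : ℕ} (π : Equiv.Perm (Fin n)) (l : Fin n → ℤ) (τ : Fin n → ℕ) : Prop :=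
  (∀ x y, x < y ↔ LexLt (colz (l x)) (τ x) (colz (l y)) (τ y)) ∧
  (∀ x y, π x < π y ↔ LexLt (rowz (l x)) (τ x) (rowz (l y)) (τ y))

theorem exists_rank {n : ℕ} (f : Fin n → ℚ) :
    ∃ τ : Fin n → ℕ, Function.Injective τ ∧ ∀ x y, f x < f y → τ x < τ y := by
  classical
  let key : Fin n → ℚ ×ₗ Fin n := fun x => toLex (f x, x)
  have hlt : ∀ x y, key x < key y → (Finset.univ.filter (fun z => key z < key x)).card <
      (Finset.univ.filter (fun z => key z < key y)).card := by
    intro x y h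
    apply Finset.card_lt_card
    rw [Finset.ssubset_iff_of_subset]
    · exact ⟨x, by simpa using h, by simp⟩
    · intro z
      simp only [Finset.mem_filter, Finset.mem_univ, true_and]
      exact fun hz => hz.trans h
  refine ⟨fun x => (Finset.univ.filter (fun z => key z < key x)).card, ?_, ?_⟩
  · intro x y h
    rcases lt_trichotomy (key x) (key y) with h1 | h1 | h1
    · exact absurd h (hlt _ _ h1).ne
    · have : (f x, x) = (f y, y) := h1
      exact (Prod.mk.inj this).2
    · exact absurd h (hlt _ _ h1).ne'
  · intro x y h
    exact hlt x y (Prod.Lex.toLex_lt_toLex.mpr (Or.inl h))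

theorem lt_iff_floor (a b : ℚ) : a < b ↔ ⌊a⌋ < ⌊b⌋ ∨ (⌊a⌋ = ⌊b⌋ ∧ Int.fract a < Int.fract b) := by
  have ha := Int.floor_add_fract a
  have hb := Int.floor_add_fract b
  constructor
  · intro h
    rcases (Int.floor_le_floor h.le).lt_or_eq with h1 | h1
    · exact Or.inl h1
    · refine Or.inr ⟨h1, ?_⟩
      rw [h1] at ha; linarith
  · rintro (h | ⟨h, h'⟩)
    · by_contra hc
      exact absurd (Int.floor_le_floor (not_lt.mp hc)) (not_le.mpr h)
    · rw [h] at ha; linarith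

theorem exists_rep {n : ℕ} (π : Equiv.Perm (Fin n)) (h : ¬ HasDecSeq π 3) :
    ∃ l τ, Function.Injective τ ∧ StairRep π l τ := by
  classical
  have h321 : ∀ x y z, x < y → y < z → π y < π x → π z < π y → False := by
    intro x y z h1 h2 h3 h4
    apply h
    refine ⟨![x, y, z], ?_, ?_⟩
    · rw [Fin.strictMono_iff_lt_succ]
      intro i; fin_cases i
      · simpa using h1
      · simpa using h2
    · rw [Fin.strictAnti_iff_succ_lt]
      intro i; fin_cases i
      · simpa using h3
      · simpa using h4
  let L : Fin n → Prop := fun y => ∃ p, p < y ∧ π y < π p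
  have hval : ∀ x y : Fin n, (π x : ℕ) = (π y : ℕ) → x = y := by
    intro x y hxy; exact π.injective (Fin.ext hxy)
  have hLL : ∀ x y, L x → L y → (x < y ↔ π x < π y) := by
    have key : ∀ x y, L x → L y → x < y → π x < π y := by
      rintro x y ⟨p, hp, hp'⟩ _ hxy
      by_contra hc
      have : π y < π x := lt_of_le_of_ne (not_lt.mp hc) (fun e => hxy.ne' (π.injective e))
      exact h321 p x y hp hxy hp' this
    intro x y hx hy
    refine ⟨key x y hx hy, fun hv => ?_⟩
    by_contra hc
    rcases (not_lt.mp hc).lt_or_eq with h1 | h1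
    · exact absurd (key y x hy hx h1) (not_lt.mpr hv.le)
    · subst h1; exact lt_irrefl _ hv
  have hU : ∀ x y, ¬ L y → x < y → π x < π y := by
    intro x y hy hxy
    by_contra hc
    exact hy ⟨x, hxy, lt_of_le_of_ne (not_lt.mp hc) (fun e => hxy.ne' (π.injective e))⟩
  obtain ⟨t, ht1, ht2, ht3⟩ := exists_times (fun v => ∃ y, (π y : ℕ) = v ∧ L y)
    (fun v w => ∃ y p, (π y : ℕ) = v ∧ p < y ∧ w ≤ (π p : ℕ))
    (by
      rintro v w w' ⟨y, p, h1, h2, h3⟩ h4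
      exact ⟨y, p, h1, h2, h4.trans h3⟩)
    (by
      rintro v v' w ⟨y, p, rfl, h2, h3⟩ hvw ⟨y', rfl, hl⟩ hn
      have hly : L y := ⟨p, h2, Fin.lt_def.mpr (lt_of_lt_of_le hvw h3)⟩
      refine Fin.lt_def.mp ((hLL y' y hl hly).mp ?_)
      by_contra hc
      exact hn ⟨y', p, rfl, lt_of_lt_of_le h2 (not_lt.mp hc), h3⟩) n
  let T : Fin n → ℚ := fun x => t (π x)
  let ε : Fin n → ℤ := fun x => if L x then 1 else 0
  have hT : ∀ x y, π x < π y → T x < T y := fun x y hxy => ht1 _ _ (Fin.lt_def.mp hxy) (π y).2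
  have hTv : ∀ x y, π x < π y ↔ T x < T y := by
    intro x y
    refine ⟨hT x y, fun hh => ?_⟩
    by_contra hc
    rcases (not_lt.mp hc).lt_or_eq with h1 | h1
    · exact absurd (hT y x h1) (not_lt.mpr hh.le)
    · have : y = x := π.injective h1
      subst this; exact lt_irrefl _ hh
  have hP1 : ∀ x y, x < y → T x + ε x < T y + ε y := by
    intro x y hxy
    by_cases hx : L x <;> by_cases hy : L y
    · simp only [ε, hx, hy, if_true]
      have := hT x y ((hLL x y hx hy).mp hxy); linarith
    · simp only [ε, hx, hy, if_true, if_false]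
      have hv := hU x y hy hxy
      have := ht3 (π x) (π y) (Fin.lt_def.mp hv) (π y).2 ⟨x, rfl, hx⟩
        (by rintro ⟨y', e, hy'⟩; rw [hval _ _ e] at hy'; exact hy hy')
        (by
          rintro ⟨x', p, e, hp, hp'⟩
          rw [hval _ _ e] at hp
          have := hU p y hy (hp.trans hxy)
          rw [Fin.lt_def] at this; omega)
      simp only [T]; push_cast; linarith
    · simp only [ε, hx, hy, if_true, if_false]
      by_cases hv : π x < π y
      · have := hT x y hv; push_cast; linarith
      · have hv' : π y < π x := lt_of_le_of_ne (not_lt.mp hv) (fun e => hxy.ne' (π.injective e))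
        have := ht2 (π y) (π x) (Fin.lt_def.mp hv') (π x).2 ⟨y, x, rfl, hxy, le_rfl⟩
        simp only [T]; push_cast; linarith
    · simp only [ε, hx, hy, if_false]
      have := hT x y (hU x y hy hxy); linarith
  have hP : ∀ x y, x < y ↔ T x + ε x < T y + ε y := by
    intro x y
    refine ⟨hP1 x y, fun hh => ?_⟩
    by_contra hc
    rcases (not_lt.mp hc).lt_or_eq with h1 | h1
    · exact absurd (hP1 y x h1) (not_lt.mpr hh.le)
    · subst h1; exact lt_irrefl _ hh
  obtain ⟨τ, hτ, hτ'⟩ := exists_rank (fun x => Int.fract (T x))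
  have hcol : ∀ x, colz (2 * ⌊T x⌋ + ε x) = ⌊T x + ε x⌋ := by
    intro x
    rw [Int.floor_add_intCast]
    by_cases hx : L x <;> simp only [ε, colz, hx, if_true, if_false] <;> omega
  have hrow : ∀ x, rowz (2 * ⌊T x⌋ + ε x) = ⌊T x⌋ := by
    intro x
    by_cases hx : L x <;> simp only [ε, rowz, hx, if_true, if_false] <;> omega
  have gen : ∀ (Y : Fin n → ℚ), (∀ x, Int.fract (Y x) = Int.fract (T x)) →
      Function.Injective Y → ∀ x y, Y x < Y y ↔ LexLt ⌊Y x⌋ (τ x) ⌊Y y⌋ (τ y) := by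
    intro Y hY hYi x y
    rw [lt_iff_floor, LexLt]
    refine or_congr Iff.rfl (and_congr_right fun hf => ?_)
    rw [hY, hY]
    refine ⟨hτ' x y, fun hh => ?_⟩
    by_contra hc
    rcases (not_lt.mp hc).lt_or_eq with h1 | h1
    · exact absurd (hτ' y x h1) (not_lt.mpr hh.le)
    · have : Y x = Y y := by
        rw [← Int.floor_add_fract (Y x), ← Int.floor_add_fract (Y y), hf, hY, hY, h1]
      rw [hYi this] at hh; exact lt_irrefl _ hh
  refine ⟨fun x => 2 * ⌊T x⌋ + ε x, τ, hτ, ?_, ?_⟩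
  · intro x y
    simp only [hcol]
    rw [hP, gen (fun x => T x + ε x) (fun x => Int.fract_add_intCast _ _)]
    intro x y hxy
    rcases lt_trichotomy x y with h1 | h1 | h1
    · exact absurd hxy (hP1 _ _ h1).ne
    · exact h1
    · exact absurd hxy (hP1 _ _ h1).ne'
  · intro x y
    simp only [hrow]
    rw [hTv, gen T (fun x => rfl)]
    intro x y hxy
    rcases lt_trichotomy (π x) (π y) with h1 | h1 | h1
    · exact absurd hxy (hT _ _ h1).ne
    · exact π.injective h1
    · exact absurd hxy (hT _ _ h1).ne'

/-! ### Direct sums and gluing -/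

theorem dsum_left {a b : ℕ} (α : Equiv.Perm (Fin a)) (β : Equiv.Perm (Fin b)) (i : Fin a) :
    dsum α β (Fin.castAdd b i) = Fin.castAdd b (α i) := by
  simp [dsum]

theorem dsum_right {a b : ℕ} (α : Equiv.Perm (Fin a)) (β : Equiv.Perm (Fin b)) (i : Fin b) :
    dsum α β (Fin.natAdd a i) = Fin.natAdd a (β i) := by
  simp [dsum]

theorem emb_left {a b : ℕ} (α : Equiv.Perm (Fin a)) (β : Equiv.Perm (Fin b)) :
    IsEmbedding α (dsum α β) (Fin.castAdd b) := by
  refine ⟨fun i j h => by simp only [Fin.lt_def, Fin.val_castAdd, Fin.val_natAdd] at *; omega, fun i j => ?_⟩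
  rw [dsum_left, dsum_left]
  simp only [Fin.lt_def, Fin.val_castAdd, Fin.val_natAdd]

theorem emb_right {a b : ℕ} (α : Equiv.Perm (Fin a)) (β : Equiv.Perm (Fin b)) :
    IsEmbedding β (dsum α β) (Fin.natAdd a) := by
  refine ⟨fun i j h => by simp only [Fin.lt_def, Fin.val_castAdd, Fin.val_natAdd] at *; omega, fun i j => ?_⟩
  rw [dsum_right, dsum_right]
  simp only [Fin.lt_def, Fin.val_castAdd, Fin.val_natAdd]; omega

theorem emb_comp {m n p : ℕ} {σ : Equiv.Perm (Fin m)} {π : Equiv.Perm (Fin n)}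
    {ρ : Equiv.Perm (Fin p)} {f : Fin m → Fin n} {g : Fin n → Fin p}
    (hf : IsEmbedding σ π f) (hg : IsEmbedding π ρ g) : IsEmbedding σ ρ (g ∘ f) :=
  ⟨hg.1.comp hf.1, fun a b => (hf.2 a b).trans (hg.2 _ _)⟩

theorem dsum_lt {a b : ℕ} (α : Equiv.Perm (Fin a)) (β : Equiv.Perm (Fin b)) (i : Fin a)
    (j : Fin b) : Fin.castAdd b i < Fin.natAdd a j ∧
      dsum α β (Fin.castAdd b i) < dsum α β (Fin.natAdd a j) := by
  rw [dsum_left, dsum_right]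
  constructor
  · simp only [Fin.lt_def, Fin.val_castAdd, Fin.val_natAdd]; omega
  · have := (α i).2
    simp only [Fin.lt_def, Fin.val_castAdd, Fin.val_natAdd]; omega

theorem glue {a b n : ℕ} {α : Equiv.Perm (Fin a)} {β : Equiv.Perm (Fin b)}
    {π : Equiv.Perm (Fin n)} {f : Fin a → Fin n} {g : Fin b → Fin n}
    (hf : IsEmbedding α π f) (hg : IsEmbedding β π g)
    (h : ∀ i j, f i < g j ∧ π (f i) < π (g j)) :
    IsEmbedding (dsum α β) π (Fin.append f g) := by
  constructor
  · intro x y hxy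
    induction x using Fin.addCases with
    | left i =>
      induction y using Fin.addCases with
      | left j =>
        rw [Fin.append_left, Fin.append_left]
        exact hf.1 (by simp only [Fin.lt_def, Fin.val_castAdd, Fin.val_natAdd] at *; omega)
      | right j => rw [Fin.append_left, Fin.append_right]; exact (h i j).1
    | right i =>
      induction y using Fin.addCases with
      | left j => exact absurd hxy (not_lt.mpr (dsum_lt α β j i).1.le)
      | right j =>
        rw [Fin.append_right, Fin.append_right]
        exact hg.1 (by simp only [Fin.lt_def, Fin.val_castAdd, Fin.val_natAdd] at *; omega)
  · intro x y
    induction x using Fin.addCases with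
    | left i =>
      induction y using Fin.addCases with
      | left j =>
        rw [Fin.append_left, Fin.append_left, ← hf.2, (emb_left α β).2]
      | right j =>
        rw [Fin.append_left, Fin.append_right]
        exact iff_of_true (dsum_lt α β i j).2 (h i j).2
    | right i =>
      induction y using Fin.addCases with
      | left j =>
        rw [Fin.append_left, Fin.append_right]
        exact iff_of_false (not_lt.mpr (dsum_lt α β j i).2.le) (not_lt.mpr (h j i).2.le)
      | right j =>
        rw [Fin.append_right, Fin.append_right, ← hg.2, (emb_right α β).2]

theorem glue3 {a b n : ℕ} {α : Equiv.Perm (Fin a)} {β : Equiv.Perm (Fin b)}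
    {π : Equiv.Perm (Fin n)} {f : Fin a → Fin n} {g : Fin b → Fin n}
    (hf : IsEmbedding α π f) (hg : IsEmbedding β π g) (x : Fin n)
    (h1 : ∀ i, f i < x ∧ π (f i) < π x) (h2 : ∀ j, x < g j ∧ π x < π (g j)) :
    ∃ F, IsEmbedding (dsum α (dsum (1 : Equiv.Perm (Fin 1)) β)) π F := by
  have hx : IsEmbedding (1 : Equiv.Perm (Fin 1)) π (fun _ => x) :=
    ⟨fun i j h => absurd h (by simp [Subsingleton.elim i j]), fun i j => by
      simp [Subsingleton.elim i j]⟩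
  refine ⟨_, glue hf (glue hx hg fun _ j => h2 j) ?_⟩
  intro i j
  induction j using Fin.addCases with
  | left j => rw [Fin.append_left]; exact h1 i
  | right j =>
    rw [Fin.append_right]
    exact ⟨(h1 i).1.trans (h2 j).1, (h1 i).2.trans (h2 j).2⟩

/-- `σ` occurs in `π` inside `S`. -/
def Occ {m n : ℕ} (σ : Equiv.Perm (Fin m)) (π : Equiv.Perm (Fin n)) (S : Set (Fin n)) : Prop :=
  ∃ f, IsEmbedding σ π f ∧ ∀ a, f a ∈ S

theorem Occ.mono {m n : ℕ} {σ : Equiv.Perm (Fin m)} {π : Equiv.Perm (Fin n)} {S T : Set (Fin n)}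
    (h : Occ σ π S) (hST : S ⊆ T) : Occ σ π T := by
  obtain ⟨f, h1, h2⟩ := h
  exact ⟨f, h1, fun a => hST (h2 a)⟩

theorem level_lt {n : ℕ} {π : Equiv.Perm (Fin n)} {l : Fin n → ℤ} {τ : Fin n → ℕ}
    (hr : StairRep π l τ) {x y : Fin n} (h : l x + 2 ≤ l y) : x < y ∧ π x < π y := by
  rw [hr.1, hr.2]
  refine ⟨Or.inl ?_, Or.inl ?_⟩
  · simp only [colz]; omega
  · simp only [rowz]; omega

theorem occ_two {a b n : ℕ} {α : Equiv.Perm (Fin a)} {β : Equiv.Perm (Fin b)}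
    {π : Equiv.Perm (Fin n)} {l : Fin n → ℤ} {τ : Fin n → ℕ}
    (hr : StairRep π l τ) (hd : 1 ≤ a + b) (m : ℤ)
    (h1 : Occ (dsum α β) π {x | l x ≤ m}) (h2 : Occ (dsum α β) π {x | m + 2 ≤ l x}) :
    ∃ F, IsEmbedding (dsum α (dsum (1 : Equiv.Perm (Fin 1)) β)) π F := by
  obtain ⟨f, hf, hf'⟩ := h1
  obtain ⟨g, hg, hg'⟩ := h2
  simp only [Set.mem_ofPred_eq] at hf' hg'
  have e1 := emb_comp (emb_left α β) hf
  have e2 := emb_comp (emb_right α β) hg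
  have hlt : ∀ x y, f x < g y ∧ π (f x) < π (g y) := fun x y =>
    level_lt hr (by have := hf' x; have := hg' y; omega)
  rcases Nat.eq_zero_or_pos a with h0 | h0
  · subst h0
    refine glue3 e1 e2 (f ⟨0, by omega⟩) (fun i => i.elim0) fun j => hlt _ _
  · refine glue3 e1 e2 (g (Fin.castAdd b ⟨0, h0⟩)) (fun i => hlt _ _) fun j => ?_
    exact ⟨hg.1 (dsum_lt α β _ _).1, (hg.2 _ _).mp (dsum_lt α β _ _).2⟩

/-! ### Universal windows -/

/-- The points `s i ℓ` witness that the window of levels `[j, j + K)` is `N`-fold interleaved. -/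
def UnivOn {n : ℕ} (l : Fin n → ℤ) (τ : Fin n → ℕ) (N : ℕ) (j : ℤ) (K : ℕ) (S : Set (Fin n))
    (s : ℕ → ℤ → Fin n) : Prop :=
  ∀ i < N, ∀ ℓ, j ≤ ℓ → ℓ < j + K → s i ℓ ∈ S ∧ l (s i ℓ) = ℓ ∧
    ∀ i' < N, i < i' → ∀ ℓ', j ≤ ℓ' → ℓ' < j + K → τ (s i ℓ) < τ (s i' ℓ')

theorem univ_emb {m n : ℕ} {σ : Equiv.Perm (Fin m)} {π : Equiv.Perm (Fin n)}
    {l : Fin n → ℤ} {τ : Fin n → ℕ} (hr : StairRep π l τ) {N K : ℕ} {j : ℤ} {S : Set (Fin n)}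
    {s : ℕ → ℤ → Fin n} (hs : UnivOn l τ N j K S s) {L : Fin m → ℤ} {r : Fin m → ℕ}
    (hσ : StairRep σ L r) (hL : ∀ x, j ≤ L x ∧ L x < j + K) (hN : ∀ x, r x < N) :
    IsEmbedding σ π (fun x => s (r x) (L x)) := by
  have hl : ∀ x, l (s (r x) (L x)) = L x := fun x => (hs _ (hN x) _ (hL x).1 (hL x).2).2.1
  have ht : ∀ x y, r x < r y → τ (s (r x) (L x)) < τ (s (r y) (L y)) := fun x y h =>
    (hs _ (hN x) _ (hL x).1 (hL x).2).2.2 _ (hN y) h _ (hL y).1 (hL y).2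
  have key : ∀ (co : ℤ → ℤ) (x y : Fin m),
      (¬ LexLt (co (L x)) (r x) (co (L y)) (r y) → ¬ LexLt (co (L y)) (r y) (co (L x)) (r x)
        → x = y) →
      (LexLt (co (L x)) (r x) (co (L y)) (r y) ↔ LexLt (co (l (s (r x) (L x))))
        (τ (s (r x) (L x))) (co (l (s (r y) (L y)))) (τ (s (r y) (L y)))) := by
    intro co x y hxy
    rw [hl, hl]
    unfold LexLt at *
    refine or_congr Iff.rfl (and_congr_right fun hc => ⟨ht x y, fun h => ?_⟩)
    by_contra hn
    rcases (not_lt.mp hn).lt_or_eq with h1 | h1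
    · exact absurd (ht y x h1) (not_lt.mpr h.le)
    · have : x = y := hxy (by omega) (by omega)
      subst this; exact lt_irrefl _ h
  constructor
  · intro x y h
    rw [hr.1, ← key colz x y ?_, ← hσ.1]
    · exact h
    · intro h1 h2
      rw [← hσ.1] at h1 h2
      exact le_antisymm (not_lt.mp h2) (not_lt.mp h1)
  · intro x y
    rw [hr.2, ← key rowz x y ?_, ← hσ.2]
    intro h1 h2
    rw [← hσ.2] at h1 h2
    exact σ.injective (le_antisymm (not_lt.mp h2) (not_lt.mp h1))

theorem rep_comp {m n : ℕ} {σ : Equiv.Perm (Fin m)} {π : Equiv.Perm (Fin n)}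
    {l : Fin n → ℤ} {τ : Fin n → ℕ} (hr : StairRep π l τ) {f : Fin m → Fin n}
    (hf : IsEmbedding σ π f) : StairRep σ (l ∘ f) (τ ∘ f) :=
  ⟨fun x y => (hf.1.lt_iff_lt).symm.trans (hr.1 _ _), fun x y => (hf.2 x y).trans (hr.2 _ _)⟩

theorem rep_rank {m : ℕ} {σ : Equiv.Perm (Fin m)} {l : Fin m → ℤ} {τ r : Fin m → ℕ}
    (hr : StairRep σ l τ) (h : ∀ x y, τ x < τ y ↔ r x < r y) : StairRep σ l r := by
  refine ⟨fun x y => ?_, fun x y => ?_⟩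
  · rw [hr.1, LexLt, LexLt, h]
  · rw [hr.2, LexLt, LexLt, h]

theorem exists_small_rank {m : ℕ} (τ : Fin m → ℕ) :
    ∃ r : Fin m → ℕ, (∀ x, r x < m) ∧ ∀ x y, τ x < τ y ↔ r x < r y := by
  classical
  have key : ∀ x y, τ x < τ y → (Finset.univ.filter (fun z => τ z < τ x)).card <
      (Finset.univ.filter (fun z => τ z < τ y)).card := by
    intro x y h
    apply Finset.card_lt_card
    rw [Finset.ssubset_iff_of_subset]
    · exact ⟨x, by simpa using h, by simp⟩
    · intro z
      simp only [Finset.mem_filter, Finset.mem_univ, true_and]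
      exact fun hz => hz.trans h
  refine ⟨fun x => (Finset.univ.filter (fun z => τ z < τ x)).card, fun x => ?_, fun x y =>
    ⟨key x y, fun h => ?_⟩⟩
  · have : (Finset.univ.filter (fun z => τ z < τ x)).card < (Finset.univ : Finset (Fin m)).card := by
      apply Finset.card_lt_card
      rw [Finset.ssubset_iff_of_subset (Finset.subset_univ _)]
      exact ⟨x, by simp, by simp⟩
    simpa using this
  · by_contra hc
    rcases (not_lt.mp hc).lt_or_eq with h1 | h1
    · exact absurd (key y x h1) (not_lt.mpr h.le)
    · simp only [h1] at h; exact lt_irrefl _ h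

theorem univ_lt {n : ℕ} {π : Equiv.Perm (Fin n)}
    {l : Fin n → ℤ} {τ : Fin n → ℕ} (hr : StairRep π l τ) {N K : ℕ} {j : ℤ} {S : Set (Fin n)}
    {s : ℕ → ℤ → Fin n} (hs : UnivOn l τ N j K S s) {i i' : ℕ} {L L' : ℤ}
    (hi : i < i') (hi' : i' < N) (h1 : j ≤ L) (h2 : L < j + K) (h1' : j ≤ L') (h2' : L' < j + K)
    (hc : colz L ≤ colz L') (hw : rowz L ≤ rowz L') :
    s i L < s i' L' ∧ π (s i L) < π (s i' L') := by
  obtain ⟨-, e1, e2⟩ := hs i (hi.trans hi') L h1 h2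
  obtain ⟨-, e1', -⟩ := hs i' hi' L' h1' h2'
  have := e2 i' hi' hi L' h1' h2'
  rw [hr.1, hr.2, e1, e1']
  exact ⟨hc.lt_or_eq.imp id fun h => ⟨h, this⟩, hw.lt_or_eq.imp id fun h => ⟨h, this⟩⟩

theorem LexLt.le {c c' : ℤ} {t t' : ℕ} (h : LexLt c t c' t') : c ≤ c' := by
  rcases h with h | h
  · exact h.le
  · exact h.1.le

theorem univ_occ {a b n : ℕ} {α : Equiv.Perm (Fin a)} {β : Equiv.Perm (Fin b)}
    {π : Equiv.Perm (Fin n)} {l : Fin n → ℤ} {τ : Fin n → ℕ}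
    (hr : StairRep π l τ) (hd : 1 ≤ a + b) {K : ℕ} {j : ℤ} {S : Set (Fin n)}
    {s : ℕ → ℤ → Fin n} (hs : UnivOn l τ (2 * (a + b) + 1) j K S s)
    {L : Fin (a + b) → ℤ} {t : Fin (a + b) → ℕ} (hδ : StairRep (dsum α β) L t)
    (hL : ∀ x, j ≤ L x ∧ L x < j + K) :
    ∃ F, IsEmbedding (dsum α (dsum (1 : Equiv.Perm (Fin 1)) β)) π F := by
  obtain ⟨r, hr1, hr2⟩ := exists_small_rank t
  have hδ' := rep_rank hδ hr2
  have eα := univ_emb hr hs (rep_comp hδ' (emb_left α β)) (fun x => hL _)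
    (fun x => by have := hr1 (Fin.castAdd b x); simp only [Function.comp]; omega)
  have eβ := univ_emb hr hs (rep_rank (r := fun x => (a + b) + 1 + r (Fin.natAdd a x))
    (rep_comp hδ' (emb_right α β)) (fun x y => by simp)) (fun x => hL _)
    (fun x => by have := hr1 (Fin.natAdd a x); omega)
  have hcw : ∀ i j, colz (L (Fin.castAdd b i)) ≤ colz (L (Fin.natAdd a j)) ∧
      rowz (L (Fin.castAdd b i)) ≤ rowz (L (Fin.natAdd a j)) := fun i j =>
    ⟨((hδ.1 _ _).mp (dsum_lt α β i j).1).le, ((hδ.2 _ _).mp (dsum_lt α β i j).2).le⟩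
  obtain ⟨x, hx1, hx2⟩ : ∃ x : Fin (a + b),
      (∀ i, colz (L (Fin.castAdd b i)) ≤ colz (L x) ∧ rowz (L (Fin.castAdd b i)) ≤ rowz (L x)) ∧
      (∀ j, colz (L x) ≤ colz (L (Fin.natAdd a j)) ∧ rowz (L x) ≤ rowz (L (Fin.natAdd a j))) := by
    rcases Nat.eq_zero_or_pos a with h0 | h0
    · subst h0
      have : Nonempty (Fin b) := ⟨⟨0, by omega⟩⟩
      obtain ⟨j, -, hj⟩ := Finset.exists_min_image (Finset.univ : Finset (Fin b))
        (fun j => L (Fin.natAdd 0 j)) Finset.univ_nonempty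
      refine ⟨Fin.natAdd 0 j, fun i => i.elim0, fun i => ?_⟩
      have := hj i (Finset.mem_univ _)
      simp only [colz, rowz]
      omega
    · have : Nonempty (Fin a) := ⟨⟨0, by omega⟩⟩
      obtain ⟨j, -, hj⟩ := Finset.exists_max_image (Finset.univ : Finset (Fin a))
        (fun j => L (Fin.castAdd b j)) Finset.univ_nonempty
      refine ⟨Fin.castAdd b j, fun i => ?_, fun i => hcw _ _⟩
      have := hj i (Finset.mem_univ _)
      simp only [colz, rowz]
      omega
  refine glue3 eα eβ (s (a + b) (L x)) (fun i => ?_) (fun i => ?_)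
  · exact univ_lt hr hs (hr1 _) (by omega) (hL _).1 (hL _).2 (hL _).1 (hL _).2 (hx1 i).1 (hx1 i).2
  · exact univ_lt hr hs (by omega) (by have := hr1 (Fin.natAdd a i); omega)
      (hL _).1 (hL _).2 (hL _).1 (hL _).2 (hx2 i).1 (hx2 i).2

theorem univ_or_split {n : ℕ} (l : Fin n → ℤ) (τ : Fin n → ℕ) (j : ℤ) (K : ℕ) (hK : 0 < K)
    (N : ℕ) (S : Set (Fin n)) : (∃ s, UnivOn l τ N j K S s) ∨
      ∃ (Θ : Finset ℕ) (κ : ℕ → ℤ), Θ.card ≤ N ∧ (∀ m, j ≤ κ m ∧ κ m < j + K) ∧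
        (∀ m m', (∀ θ ∈ Θ, (θ < m ↔ θ < m') ∧ (m < θ ↔ m' < θ)) → κ m = κ m') ∧
        ∀ x ∈ S, τ x ∉ Θ → l x ≠ κ (τ x) := by
  classical
  induction N generalizing S with
  | zero =>
    by_cases hn : Nonempty (Fin n)
    · left
      exact ⟨fun _ _ => hn.some, fun i hi => absurd hi (by omega)⟩
    · right
      exact ⟨∅, fun _ => j, by simp, fun _ => ⟨le_rfl, by dsimp only; omega⟩, fun _ _ _ => rfl,
        fun x => absurd ⟨x⟩ hn⟩
  | succ N ih =>
    by_cases hmiss : ∃ ℓ, j ≤ ℓ ∧ ℓ < j + K ∧ ∀ x ∈ S, l x ≠ ℓ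
    · obtain ⟨ℓ, h1, h2, h3⟩ := hmiss
      right
      exact ⟨∅, fun _ => ℓ, by simp, fun _ => ⟨h1, h2⟩, fun _ _ _ => rfl, fun x hx _ => h3 x hx⟩
    · push Not at hmiss
      have hp : ∀ ℓ, ∃ p, j ≤ ℓ → ℓ < j + K → p ∈ S ∧ l p = ℓ ∧
          ∀ y ∈ S, l y = ℓ → τ p ≤ τ y := by
        intro ℓ
        by_cases hℓ : j ≤ ℓ ∧ ℓ < j + K
        · obtain ⟨x, hx, hx'⟩ := hmiss ℓ hℓ.1 hℓ.2
          obtain ⟨p, hp, hp'⟩ := Finset.exists_min_image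
            (Finset.univ.filter fun y => y ∈ S ∧ l y = ℓ) τ ⟨x, by simp [hx, hx']⟩
          simp only [Finset.mem_filter, Finset.mem_univ, true_and] at hp hp'
          exact ⟨p, fun _ _ => ⟨hp.1, hp.2, fun y h1 h2 => hp' y ⟨h1, h2⟩⟩⟩
        · obtain ⟨x, hx, hx'⟩ := hmiss j le_rfl (by omega)
          exact ⟨x, fun h1 h2 => absurd ⟨h1, h2⟩ hℓ⟩
      choose p hp using hp
      obtain ⟨ℓ₀, hℓ₀, hmax⟩ := Finset.exists_max_image (Finset.Ico j (j + K))
        (fun ℓ => τ (p ℓ)) ⟨j, by simp; omega⟩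
      simp only [Finset.mem_Ico] at hℓ₀ hmax
      obtain ⟨q1, q2, q3⟩ := hp ℓ₀ hℓ₀.1 hℓ₀.2
      rcases ih (S ∩ {x | τ (p ℓ₀) < τ x}) with ⟨s, hs⟩ | ⟨Θ, κ, h1, h2, h3, h4⟩
      · left
        refine ⟨fun i ℓ => Nat.casesOn i (p ℓ) (fun i' => s i' ℓ), ?_⟩
        intro i hi ℓ hℓ hℓ'
        cases i with
        | zero =>
          obtain ⟨u1, u2, u3⟩ := hp ℓ hℓ hℓ'
          refine ⟨u1, u2, ?_⟩
          intro i' hi' hii ℓ' g1 g2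
          cases i' with
          | zero => exact absurd hii (by omega)
          | succ i' =>
            exact lt_of_le_of_lt (hmax ℓ ⟨hℓ, hℓ'⟩) (hs i' (by omega) ℓ' g1 g2).1.2
        | succ i =>
          obtain ⟨u1, u2, u3⟩ := hs i (by omega) ℓ hℓ hℓ'
          refine ⟨u1.1, u2, ?_⟩
          intro i' hi' hii ℓ' g1 g2
          cases i' with
          | zero => exact absurd hii (by omega)
          | succ i' => exact u3 i' (by omega) (by omega) ℓ' g1 g2
      · right
        refine ⟨insert (τ (p ℓ₀)) Θ, fun t => if t < τ (p ℓ₀) then ℓ₀ else κ t,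
          (Finset.card_insert_le _ _).trans (by omega), ?_, ?_, ?_⟩
        · intro m
          dsimp only
          split_ifs
          · exact hℓ₀
          · exact h2 m
        · intro m m' h
          have e1 := h _ (Finset.mem_insert_self _ _)
          have e2 := h3 m m' fun θ hθ => h θ (Finset.mem_insert_of_mem hθ)
          simp only [e1.2, e2]
        · intro x hx hxΘ
          rw [Finset.mem_insert, not_or] at hxΘ
          dsimp only
          split_ifs with hlt
          · intro he
            exact absurd (q3 x hx he) (not_le.mpr hlt)
          · exact h4 x ⟨hx, by simp only [Set.mem_ofPred_eq]; omega⟩ hxΘ.2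

/-! ### Sets cut out by few thresholds -/

/-- Membership in `S` is determined by comparing `v` with at most `k` thresholds. -/
def Simple {n : ℕ} (v : Fin n → ℕ) (k : ℕ) (S : Set (Fin n)) : Prop :=
  ∃ F : Finset ℕ, F.card ≤ k ∧ ∀ x y, (∀ c ∈ F, (v x < c ↔ v y < c)) → (x ∈ S ↔ y ∈ S)

theorem Simple.mono {n : ℕ} {v : Fin n → ℕ} {k k' : ℕ} {S : Set (Fin n)} (h : Simple v k S)
    (hk : k ≤ k') : Simple v k' S := by
  obtain ⟨F, h1, h2⟩ := h
  exact ⟨F, h1.trans hk, h2⟩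

theorem lower_threshold {n : ℕ} (v : Fin n → ℕ) (U : Set (Fin n))
    (hU : ∀ x y, x ∈ U → v y ≤ v x → y ∈ U) : ∃ c, ∀ x, x ∈ U ↔ v x < c := by
  classical
  refine ⟨(Finset.univ.filter (· ∈ U)).sup (fun x => v x + 1), fun x => ?_⟩
  rw [Finset.lt_sup_iff]
  constructor
  · intro hx
    exact ⟨x, by simpa using hx, by omega⟩
  · rintro ⟨y, hy, hxy⟩
    exact hU y x (by simpa using hy) (by omega)

theorem simple_split {n : ℕ} {l : Fin n → ℤ} {τ : Fin n → ℕ} (hτ : Function.Injective τ)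
    (v : Fin n → ℕ) (co : ℤ → ℤ) (e : ℤ) (hco : ∀ z, co z = (z + e) / 2)
    (hv : ∀ x y, v x < v y ↔ LexLt (co (l x)) (τ x) (co (l y)) (τ y))
    {j : ℤ} {K N k : ℕ} {S : Set (Fin n)} (hS : Simple v k S)
    {Θ : Finset ℕ} {κ : ℕ → ℤ} (hΘ : Θ.card ≤ N) (hκ : ∀ m, j ≤ κ m ∧ κ m < j + K)
    (hκ' : ∀ m m', (∀ θ ∈ Θ, (θ < m ↔ θ < m') ∧ (m < θ ↔ m' < θ)) → κ m = κ m')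
    (hn : ∀ x ∈ S, τ x ∉ Θ → l x ≠ κ (τ x)) :
    Simple v (k + (K + 3) * (2 * N + 1)) {x | x ∈ S ∧ l x < κ (τ x)} ∧
    Simple v (k + (K + 3) * (2 * N + 1)) {x | x ∈ S ∧ κ (τ x) < l x} := by
  classical
  obtain ⟨F, hF, hFS⟩ := hS
  have hthr : ∀ p : ℕ × ℕ, ∃ c, ∀ x, LexLt (co (l x)) (τ x) (co j + p.1) p.2 ↔ v x < c := by
    intro p
    refine lower_threshold v {x | LexLt (co (l x)) (τ x) (co j + p.1) p.2} ?_
    intro x y hx hxy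
    have h1 := not_lt.mpr hxy
    rw [hv] at h1
    simp only [Set.mem_ofPred_eq, LexLt] at *
    omega
  choose c hc using hthr
  let G := F ∪ ((Finset.range (K + 3)) ×ˢ (insert 0 (Θ ∪ Θ.image (· + 1)))).image c
  have hG : G.card ≤ k + (K + 3) * (2 * N + 1) := by
    refine (Finset.card_union_le _ _).trans (add_le_add hF (Finset.card_image_le.trans ?_))
    rw [Finset.card_product, Finset.card_range]
    refine Nat.mul_le_mul_left _ ((Finset.card_insert_le _ _).trans ?_)
    have h1 := Finset.card_union_le Θ (Θ.image (· + 1))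
    have h2 : (Θ.image (· + 1)).card ≤ Θ.card := Finset.card_image_le
    omega
  have main : ∀ x y, (∀ c ∈ G, (v x < c ↔ v y < c)) → x ∈ S → y ∈ S →
      (l x < κ (τ x) ↔ l y < κ (τ y)) ∧ (κ (τ x) < l x ↔ κ (τ y) < l y) := by
    intro x y h hx hy
    have hlex : ∀ i < K + 3, ∀ θ ∈ insert 0 (Θ ∪ Θ.image (· + 1)),
        (LexLt (co (l x)) (τ x) (co j + i) θ ↔ LexLt (co (l y)) (τ y) (co j + i) θ) := by
      intro i hi θ hθ
      rw [hc (i, θ), hc (i, θ)]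
      exact h _ (Finset.mem_union_right _ (Finset.mem_image_of_mem c
        (Finset.mem_product.mpr ⟨Finset.mem_range.mpr hi, hθ⟩)))
    have h0 : ∀ i < K + 3, (co (l x) < co j + i ↔ co (l y) < co j + i) := by
      intro i hi
      have := hlex i hi 0 (Finset.mem_insert_self _ _)
      simpa [LexLt] using this
    have kx := hκ (τ x)
    have ky := hκ (τ y)
    have a0 := h0 0 (by omega)
    have aK := h0 (K + 2) (by omega)
    push_cast at a0 aK
    rw [hco, hco, hco] at a0 aK
    by_cases c1 : (l x + e) / 2 < (j + e) / 2
    · omega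
    by_cases c2 : (l x + e) / 2 < (j + e) / 2 + (K + 2)
    · have hcol : co (l x) = co (l y) := by
        have b1 := h0 (co (l x) - co j).toNat (by rw [hco, hco]; omega)
        have b2 := h0 ((co (l x) - co j).toNat + 1) (by rw [hco, hco]; omega)
        simp only [hco] at *
        push_cast at *
        omega
      have ht : ∀ θ ∈ insert 0 (Θ ∪ Θ.image (· + 1)), (τ x < θ ↔ τ y < θ) := by
        intro θ hθ
        have b := hlex (co (l x) - co j).toNat (by rw [hco, hco]; omega) θ hθ
        have e1 : co j + ((co (l x) - co j).toNat : ℤ) = co (l x) := by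
          rw [hco, hco]; omega
        rw [e1, ← hcol] at b
        simpa [LexLt] using b
      have ht1 : ∀ θ ∈ Θ, (τ x < θ ↔ τ y < θ) := fun θ hθ => ht θ (by simp [hθ])
      have ht2 : ∀ θ ∈ Θ, (τ x < θ + 1 ↔ τ y < θ + 1) := fun θ hθ => ht (θ + 1) (by simp [hθ])
      have hk : κ (τ x) = κ (τ y) := hκ' _ _ fun θ hθ => by
        have := ht1 θ hθ
        have := ht2 θ hθ
        omega
      by_cases hxΘ : τ x ∈ Θ
      · have : x = y := hτ (by have := ht1 _ hxΘ; have := ht2 _ hxΘ; omega)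
        subst this; simp
      by_cases hyΘ : τ y ∈ Θ
      · have : x = y := hτ (by have := ht1 _ hyΘ; have := ht2 _ hyΘ; omega)
        subst this; simp
      have n1 := hn x hx hxΘ
      have n2 := hn y hy hyΘ
      rw [hco, hco] at hcol
      omega
    · omega
  have hGS : ∀ x y, (∀ c ∈ G, (v x < c ↔ v y < c)) → (x ∈ S ↔ y ∈ S) := fun x y h =>
    hFS x y fun c hc => h c (Finset.mem_union_left _ hc)
  constructor
  · refine ⟨G, hG, fun x y h => ?_⟩
    have := hGS x y h
    constructor
    · rintro ⟨h1, h2⟩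
      exact ⟨this.mp h1, (main x y h h1 (this.mp h1)).1.mp h2⟩
    · rintro ⟨h1, h2⟩
      exact ⟨this.mpr h1, (main x y h (this.mpr h1) h1).1.mpr h2⟩
  · refine ⟨G, hG, fun x y h => ?_⟩
    have := hGS x y h
    constructor
    · rintro ⟨h1, h2⟩
      exact ⟨this.mp h1, (main x y h h1 (this.mp h1)).2.mp h2⟩
    · rintro ⟨h1, h2⟩
      exact ⟨this.mpr h1, (main x y h (this.mpr h1) h1).2.mpr h2⟩

/-- Simple both by position and by value. -/
def Simple2 {n : ℕ} (π : Equiv.Perm (Fin n)) (k : ℕ) (S : Set (Fin n)) : Prop :=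
  Simple (fun x => (x : ℕ)) k S ∧ Simple (fun x => (π x : ℕ)) k S

theorem Simple2.mono {n : ℕ} {π : Equiv.Perm (Fin n)} {k k' : ℕ} {S : Set (Fin n)}
    (h : Simple2 π k S) (hk : k ≤ k') : Simple2 π k' S :=
  ⟨h.1.mono hk, h.2.mono hk⟩

theorem simple2_split {n : ℕ} {π : Equiv.Perm (Fin n)} {l : Fin n → ℤ} {τ : Fin n → ℕ}
    (hτ : Function.Injective τ) (hr : StairRep π l τ)
    {j : ℤ} {K N k : ℕ} (hK : 0 < K) {S : Set (Fin n)} (hS : Simple2 π k S)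
    (hnu : ¬ ∃ s, UnivOn l τ N j K S s) :
    ∃ (P Q : Set (Fin n)) (Z : Finset (Fin n)), P ⊆ S ∧ Q ⊆ S ∧ Z.card ≤ N ∧
      S ⊆ P ∪ Q ∪ Z ∧ Simple2 π (k + (K + 3) * (2 * N + 1)) P ∧
      Simple2 π (k + (K + 3) * (2 * N + 1)) Q ∧ (∀ x ∈ P, l x < j + K - 1) ∧
      (∀ x ∈ Q, j < l x) := by
  classical
  rcases univ_or_split l τ j K hK N S with h | ⟨Θ, κ, h1, h2, h3, h4⟩
  · exact absurd h hnu
  have s1 := simple_split hτ (fun x => (x : ℕ)) colz 1 (fun z => rfl)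
    (fun x y => (Fin.lt_def.symm.trans (hr.1 x y))) hS.1 h1 h2 h3 h4
  have s2 := simple_split hτ (fun x => (π x : ℕ)) rowz 0 (fun z => by simp [rowz])
    (fun x y => (Fin.lt_def.symm.trans (hr.2 x y))) hS.2 h1 h2 h3 h4
  refine ⟨{x | x ∈ S ∧ l x < κ (τ x)}, {x | x ∈ S ∧ κ (τ x) < l x},
    Finset.univ.filter (fun x => τ x ∈ Θ), fun x hx => hx.1, fun x hx => hx.1, ?_, ?_,
    ⟨s1.1, s2.1⟩, ⟨s1.2, s2.2⟩, ?_, ?_⟩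
  · refine le_trans ?_ h1
    exact Finset.card_le_card_of_injOn τ (fun x hx => by simpa using hx) hτ.injOn
  · intro x hx
    by_cases hxΘ : τ x ∈ Θ
    · right; simpa using hxΘ
    · left
      rcases lt_or_gt_of_ne (h4 x hx hxΘ) with h | h
      · exact Or.inl ⟨hx, h⟩
      · exact Or.inr ⟨hx, h⟩
  · rintro x ⟨-, hx⟩
    have := h2 (τ x)
    omega
  · rintro x ⟨-, hx⟩
    have := h2 (τ x)
    omega

/-! ### Decompositions into boundedly many simple sets avoiding `σ` -/

/-- `S` is covered by at most `B` simple sets avoiding `σ`. -/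
def DecB {m n : ℕ} (σ : Equiv.Perm (Fin m)) (π : Equiv.Perm (Fin n)) (B : ℕ)
    (S : Set (Fin n)) : Prop :=
  ∃ L : List (Set (Fin n)), L.length ≤ B ∧ (∀ T ∈ L, ¬ Occ σ π T ∧ Simple2 π B T) ∧
    ∀ x ∈ S, ∃ T ∈ L, x ∈ T

theorem DecB.mono {m n : ℕ} {σ : Equiv.Perm (Fin m)} {π : Equiv.Perm (Fin n)} {B B' : ℕ}
    {S S' : Set (Fin n)} (h : DecB σ π B S) (hB : B ≤ B') (hS : S' ⊆ S) : DecB σ π B' S' := by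
  obtain ⟨L, h1, h2, h3⟩ := h
  exact ⟨L, h1.trans hB, fun T hT => ⟨(h2 T hT).1, (h2 T hT).2.mono hB⟩, fun x hx => h3 x (hS hx)⟩

theorem DecB.union {m n : ℕ} {σ : Equiv.Perm (Fin m)} {π : Equiv.Perm (Fin n)} {B B' : ℕ}
    {S S' : Set (Fin n)} (h : DecB σ π B S) (h' : DecB σ π B' S') :
    DecB σ π (B + B') (S ∪ S') := by
  obtain ⟨L, h1, h2, h3⟩ := h
  obtain ⟨L', h1', h2', h3'⟩ := h'
  refine ⟨L ++ L', by rw [List.length_append]; omega, fun T hT => ?_, fun x hx => ?_⟩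
  · rcases List.mem_append.mp hT with hT | hT
    · exact ⟨(h2 T hT).1, (h2 T hT).2.mono (by omega)⟩
    · exact ⟨(h2' T hT).1, (h2' T hT).2.mono (by omega)⟩
  · rcases hx with hx | hx
    · obtain ⟨T, hT, hxT⟩ := h3 x hx
      exact ⟨T, List.mem_append_left _ hT, hxT⟩
    · obtain ⟨T, hT, hxT⟩ := h3' x hx
      exact ⟨T, List.mem_append_right _ hT, hxT⟩

theorem decB_self {m n : ℕ} {σ : Equiv.Perm (Fin m)} {π : Equiv.Perm (Fin n)} {k : ℕ}
    {S : Set (Fin n)} (h : ¬ Occ σ π S) (hS : Simple2 π k S) : DecB σ π (k + 1) S :=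
  ⟨[S], by simp, fun T hT => by
    rw [List.mem_singleton] at hT; subst hT; exact ⟨h, hS.mono (by omega)⟩,
    fun x hx => ⟨S, by simp, hx⟩⟩

theorem simple_singleton {n : ℕ} (v : Fin n → ℕ) (hv : Function.Injective v) (z : Fin n) :
    Simple v 2 {z} := by
  refine ⟨{v z, v z + 1}, Finset.card_le_two, fun x y h => ?_⟩
  have h1 := h (v z) (by simp)
  have h2 := h (v z + 1) (by simp)
  simp only [Set.mem_singleton_iff]
  rw [← hv.eq_iff, ← hv.eq_iff (a := y)]
  omega

theorem decB_finset {m n : ℕ} {σ : Equiv.Perm (Fin m)} {π : Equiv.Perm (Fin n)} (hm : 2 ≤ m)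
    {N : ℕ} {Z : Finset (Fin n)} (hZ : Z.card ≤ N) : DecB σ π (N + 2) (Z : Set (Fin n)) := by
  refine ⟨Z.toList.map (fun z => {z}), by simp; omega, fun T hT => ?_, fun x hx => ?_⟩
  · rw [List.mem_map] at hT
    obtain ⟨z, -, rfl⟩ := hT
    refine ⟨?_, ?_, ?_⟩
    · rintro ⟨f, hf, hf'⟩
      have h1 := hf' ⟨0, by omega⟩
      have h2 := hf' ⟨1, by omega⟩
      have h3 : (⟨0, by omega⟩ : Fin m) = ⟨1, by omega⟩ := hf.1.injective (by
        rw [Set.mem_singleton_iff] at h1 h2; rw [h1, h2])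
      simp at h3
    · exact (simple_singleton _ Fin.val_injective z).mono (by omega)
    · exact (simple_singleton (fun x => (π x : ℕ))
        (fun x y h => π.injective (Fin.val_injective h)) z).mono (by omega)
  · exact ⟨{x}, List.mem_map.mpr ⟨x, by simpa using hx, rfl⟩, rfl⟩

theorem bounded_dec {a b : ℕ} (α : Equiv.Perm (Fin a)) (β : Equiv.Perm (Fin b))
    (hd : 2 ≤ a + b) (K : ℕ) : ∀ k : ℕ, ∃ B : ℕ, ∀ (n : ℕ) (π : Equiv.Perm (Fin n))
      (l : Fin n → ℤ) (τ : Fin n → ℕ), Function.Injective τ → StairRep π l τ →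
      (¬ ∃ F, IsEmbedding (dsum α (dsum (1 : Equiv.Perm (Fin 1)) β)) π F) →
      ∀ (j : ℤ) (S : Set (Fin n)), Simple2 π k S → (∀ x ∈ S, j ≤ l x ∧ l x < j + K) →
        DecB (dsum α β) π B S := by
  induction K with
  | zero =>
    intro k
    refine ⟨k + 1, fun n π l τ hτ hr hγ j S hS hl => decB_self ?_ hS⟩
    rintro ⟨f, -, hf⟩
    have := hl _ (hf ⟨0, by omega⟩)
    push_cast at this
    omega
  | succ K ih =>
    intro k
    obtain ⟨B, hB⟩ := ih (k + (K + 1 + 3) * (2 * (2 * (a + b) + 1) + 1))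
    refine ⟨(k + 1) + (B + B + (2 * (a + b) + 1 + 2)), fun n π l τ hτ hr hγ j S hS hl => ?_⟩
    by_cases hu : ∃ s, UnivOn l τ (2 * (a + b) + 1) j (K + 1) S s
    · obtain ⟨s, hs⟩ := hu
      refine (decB_self (k := k) ?_ hS).mono (by omega) subset_rfl
      rintro ⟨f, hf, hf'⟩
      exact hγ (univ_occ hr (by omega) hs (rep_comp hr hf) fun x => hl _ (hf' x))
    · obtain ⟨P, Q, Z, hP, hQ, hZ, hcov, sP, sQ, lP, lQ⟩ :=
        simple2_split hτ hr (Nat.succ_pos K) hS hu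
      have dP := hB n π l τ hτ hr hγ j P sP fun x hx => ⟨(hl x (hP hx)).1, by
        have := lP x hx; push_cast at this; omega⟩
      have dQ := hB n π l τ hτ hr hγ (j + 1) Q sQ fun x hx => by
        have h1 := lQ x hx
        have h2 := (hl x (hQ hx)).2
        push_cast at h2
        omega
      exact ((dP.union dQ).union (decB_finset hd hZ)).mono (by omega) hcov

theorem rep_shift {m : ℕ} {σ : Equiv.Perm (Fin m)} {l : Fin m → ℤ} {r : Fin m → ℕ}
    (h : StairRep σ l r) (c : ℤ) : StairRep σ (fun x => l x + 2 * c) r := by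
  have e1 : ∀ z, colz (z + 2 * c) = colz z + c := fun z => by simp only [colz]; omega
  have e2 : ∀ z, rowz (z + 2 * c) = rowz z + c := fun z => by simp only [rowz]; omega
  refine ⟨fun x y => ?_, fun x y => ?_⟩
  · rw [h.1]; simp only [LexLt, e1]; omega
  · rw [h.2]; simp only [LexLt, e2]; omega

theorem exists_bound {m : ℕ} (l : Fin m → ℤ) : ∃ M : ℕ, ∀ x, -(M : ℤ) ≤ l x ∧ l x ≤ M := by
  refine ⟨Finset.univ.sup fun x => (l x).natAbs, fun x => ?_⟩
  have : (l x).natAbs ≤ Finset.univ.sup fun x => (l x).natAbs :=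
    Finset.le_sup (f := fun x => (l x).natAbs) (Finset.mem_univ x)
  omega

theorem global_dec {a b : ℕ} (α : Equiv.Perm (Fin a)) (β : Equiv.Perm (Fin b))
    (hd : 2 ≤ a + b) (hδ : ¬ HasDecSeq (dsum α β) 3) : ∃ B : ℕ, ∀ (n : ℕ)
      (π : Equiv.Perm (Fin n)) (l : Fin n → ℤ) (τ : Fin n → ℕ), Function.Injective τ →
      StairRep π l τ → (¬ ∃ F, IsEmbedding (dsum α (dsum (1 : Equiv.Perm (Fin 1)) β)) π F) →
        DecB (dsum α β) π B Set.univ := by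
  obtain ⟨L, r, -, hL⟩ := exists_rep _ hδ
  obtain ⟨M, hM⟩ := exists_bound L
  let K0 := 4 * M + 1
  let N := 2 * (a + b) + 1
  let k1 := 0 + (K0 + 3) * (2 * N + 1)
  let k2 := k1 + (K0 + 3) * (2 * N + 1)
  obtain ⟨B0, hB0⟩ := bounded_dec α β hd (2 * K0 + 1) k2
  refine ⟨1 + ((k1 + 1) + (B0 + (k2 + 1) + (N + 2)) + (N + 2)), fun n π l τ hτ hr hγ => ?_⟩
  have hsu : Simple2 π 0 Set.univ :=
    ⟨⟨∅, by simp, by simp⟩, ⟨∅, by simp, by simp⟩⟩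
  have hnu : ∀ c S, ¬ ∃ s, UnivOn l τ N (2 * c) K0 S s := by
    rintro c S ⟨s, hs⟩
    refine hγ (univ_occ hr (by omega) hs (rep_shift hL (c + M)) fun x => ?_)
    have := hM x
    simp only [K0]
    push_cast
    omega
  by_cases hocc : Occ (dsum α β) π Set.univ
  swap
  · exact (decB_self hocc hsu).mono (by omega) subset_rfl
  obtain ⟨M', hM'⟩ := exists_bound l
  obtain ⟨j0, hj0, hmin⟩ := Int.exists_least_of_bdd
    (P := fun z => Occ (dsum α β) π {x | l x ≤ z})
    ⟨-(M' : ℤ), by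
      rintro z ⟨f, -, hf⟩
      have := hf ⟨0, by omega⟩
      have := hM' (f ⟨0, by omega⟩)
      simp only [Set.mem_ofPred_eq] at *
      omega⟩
    ⟨M', hocc.mono fun x _ => (hM' x).2⟩
  have hlow : ¬ Occ (dsum α β) π {x | l x ≤ j0 - 1} := fun h => by
    have := hmin _ h; omega
  have hhigh : ¬ Occ (dsum α β) π {x | j0 + 2 ≤ l x} := fun h =>
    hγ (occ_two hr (by omega) j0 hj0 h)
  have hK0 : 0 < K0 := by simp only [K0]; omega
  obtain ⟨P, Q, Z, hP, hQ, hZ, hcov, sP, sQ, lP, lQ⟩ :=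
    simple2_split hτ hr hK0 hsu (hnu ((j0 - K0 + 1) / 2) Set.univ)
  obtain ⟨P', Q', Z', hP', hQ', hZ', hcov', sP', sQ', lP', lQ'⟩ :=
    simple2_split hτ hr hK0 sQ (hnu ((j0 + 2) / 2) Q)
  have dP : DecB (dsum α β) π (k1 + 1) P := decB_self (fun h => hlow (h.mono fun x hx => by
    have := lP x hx
    simp only [Set.mem_ofPred_eq]; omega)) sP
  have dQ' : DecB (dsum α β) π (k2 + 1) Q' := decB_self (fun h => hhigh (h.mono fun x hx => by
    have := lQ' x hx
    simp only [Set.mem_ofPred_eq]; omega)) sQ'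
  have dP' : DecB (dsum α β) π B0 P' :=
    hB0 n π l τ hτ hr hγ (2 * ((j0 - K0 + 1) / 2) + 1) P' sP' fun x hx => by
      have h1 := lP' x hx
      have h2 := lQ x (hP' hx)
      push_cast
      omega
  refine ((dP.union ((dP'.union dQ').union (decB_finset hd hZ'))).union (decB_finset hd hZ)).mono
    (by omega) ?_
  intro x hx
  rcases hcov hx with (h | h) | h
  · exact Or.inl (Or.inl h)
  · exact Or.inl (Or.inr (hcov' h))
  · exact Or.inr h

theorem findIdx_eq {A : Type*} (L : List A) (p q : A → Bool) (h : ∀ t ∈ L, p t = q t) :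
    L.findIdx p = L.findIdx q := by
  induction L with
  | nil => rfl
  | cons t L ih =>
    rw [List.findIdx_cons, List.findIdx_cons, h t (by simp), ih fun t ht => h t (by simp [ht])]

theorem coloring_of_dec {m n : ℕ} {σ : Equiv.Perm (Fin m)} {π : Equiv.Perm (Fin n)} {B : ℕ}
    (hm : 1 ≤ m) (h : DecB σ π B Set.univ) : ∃ χ : Fin n → Fin (B + 1),
      Blk (B * B) (fun x => (x : ℕ)) χ ∧ Blk (B * B) (fun x => (π x : ℕ)) χ ∧
      ∀ i, ¬ Occ σ π {x | χ x = i} := by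
  classical
  obtain ⟨L, h1, h2, h3⟩ := h
  have hlt : ∀ x, L.findIdx (fun T => decide (x ∈ T)) < L.length := by
    intro x
    rw [List.findIdx_lt_length]
    obtain ⟨T, hT, hx⟩ := h3 x (Set.mem_univ _)
    exact ⟨T, hT, by simpa using hx⟩
  have blk : ∀ v : Fin n → ℕ, (∀ T ∈ L, Simple v B T) →
      Blk (B * B) v (fun x => (⟨L.findIdx (fun T => decide (x ∈ T)), by
        have := hlt x; omega⟩ : Fin (B + 1))) := by
    intro v hv
    choose! F hF hF' using hv
    refine ⟨L.toFinset.biUnion F, ?_, fun x y hxy => ?_⟩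
    · refine (Finset.card_biUnion_le_card_mul _ _ B fun T hT => hF T (by simpa using hT)).trans ?_
      exact Nat.mul_le_mul_right _ ((List.toFinset_card_le L).trans h1)
    · rw [Fin.mk.injEq]
      refine findIdx_eq _ _ _ fun T hT => ?_
      have := hF' T hT x y fun c hc => hxy c (Finset.mem_biUnion.mpr ⟨T, by simpa using hT, hc⟩)
      simp [this]
  refine ⟨_, blk _ fun T hT => (h2 T hT).2.1, blk _ fun T hT => (h2 T hT).2.2, ?_⟩
  rintro i ⟨f, hf, hf'⟩
  have hi : (i : ℕ) < L.length := by
    rw [← hf' ⟨0, by omega⟩]; exact hlt _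
  refine (h2 (L[(i : ℕ)]) (List.getElem_mem _)).1 ⟨f, hf, fun x => ?_⟩
  have e : L.findIdx (fun T => decide (f x ∈ T)) = i := congrArg Fin.val (hf' x)
  have := List.findIdx_getElem (xs := L) (p := fun T => decide (f x ∈ T)) (w := hlt _)
  simp only [e, decide_eq_true_eq] at this
  exact this

theorem involves_trans {ρ σ π : PermSig} (h : Involves ρ σ) (h' : Involves σ π) :
    Involves ρ π := by
  obtain ⟨f, hf⟩ := h
  obtain ⟨g, hg⟩ := h'
  exact ⟨_, emb_comp hf hg⟩

theorem ik_down {k : ℕ} {σ π : PermSig} (h : Involves σ π) (hπ : π ∈ IkClass k) :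
    σ ∈ IkClass k := by
  obtain ⟨f, hf⟩ := h
  rintro ⟨q, hq, hq'⟩
  exact hπ ⟨f ∘ q, hf.1.comp hq, fun i j hij => (hf.2 _ _).mp (hq' hij)⟩

theorem av_down {X : Set PermSig} {σ π : PermSig} (h : Involves σ π) (hπ : π ∈ AvClass X) :
    σ ∈ AvClass X := fun ρ hρ hρσ => hπ ρ hρ (involves_trans hρσ h)

theorem two_le_of_infinite (D : Set PermSig) (δ : PermSig)
    (hinf : (D ∩ AvClass {δ}).Infinite) : 2 ≤ δ.1 := by
  by_contra hlt
  apply hinf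
  refine (Set.finite_singleton (⟨0, 1⟩ : PermSig)).subset ?_
  rintro ⟨n, π⟩ ⟨-, hav⟩
  rcases Nat.eq_zero_or_pos n with h0 | h0
  · subst h0
    rw [Set.mem_singleton_iff, Subsingleton.elim π 1]
  · exfalso
    have hs : Subsingleton (Fin δ.1) := Fin.subsingleton_iff_le_one.mpr (by omega)
    refine hav δ rfl ⟨fun _ => ⟨0, h0⟩, fun x y hxy => ?_, fun x y => ?_⟩
    · rw [Subsingleton.elim x y] at hxy; exact absurd hxy (lt_irrefl _)
    · rw [Subsingleton.elim x y]; simp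

/-- If `X ⊆ I₂`, `α, β ∈ I₂` with `α` 2-rigid, `α ⊕ β ∈ I₂ ∩ Av(X)`, and
`C = I₂ ∩ Av(X) ∩ Av(α ⊕ β)` is infinite, then `C` and
`C' = I₂ ∩ Av(X) ∩ Av(α ⊕ 1 ⊕ β)` have the same growth rate. -/
theorem growthRate_av_rigid_oneSum (X : Set PermSig) (hX : X ⊆ IkClass 2)
    (α β : PermSig) (hα : α ∈ IkClass 2) (hβ : β ∈ IkClass 2)
    (hrig : KRigid 2 α.2)
    (hαβ : DSum α β ∈ IkClass 2 ∩ AvClass X)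
    (hinf : (IkClass 2 ∩ AvClass X ∩ AvClass {DSum α β}).Infinite) :
    growthRate (IkClass 2 ∩ AvClass X ∩ AvClass {DSum α β}) =
      growthRate (IkClass 2 ∩ AvClass X ∩ AvClass {DSum α (DSum (iotaSig 1) β)}) := by

  have hd : 2 ≤ α.1 + β.1 := two_le_of_infinite _ _ hinf
  have hinv : Involves (DSum α β) (DSum α (DSum (iotaSig 1) β)) :=
    ⟨_, glue (emb_left α.2 (dsum (1 : Equiv.Perm (Fin 1)) β.2))
      (emb_comp (emb_right (1 : Equiv.Perm (Fin 1)) β.2) (emb_right α.2 (dsum 1 β.2)))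
      fun i j => dsum_lt α.2 _ _ _⟩
  apply le_antisymm
  · apply growth_mono
    rintro π ⟨h1, h2⟩
    refine ⟨h1, ?_⟩
    rintro ρ rfl h
    exact h2 _ rfl (involves_trans hinv h)
  · obtain ⟨B, hB⟩ := global_dec α.2 β.2 hd hαβ.1
    apply growth_le_of_coloring _ _ B (B * B)
    rintro n π ⟨⟨h1, h2⟩, h3⟩
    obtain ⟨l, τ, hτ, hr⟩ := exists_rep π h1
    obtain ⟨χ, c1, c2, c3⟩ := coloring_of_dec (by omega)
      (hB n π l τ hτ hr fun hF => h3 _ rfl hF)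
    refine ⟨χ, c1, c2, fun i => ?_⟩
    have hp := pat_emb π (Finset.univ.filter (χ · = i))
    have hp' : Involves ⟨_, pat π (Finset.univ.filter (χ · = i))⟩ ⟨n, π⟩ := ⟨_, hp⟩
    refine ⟨⟨ik_down hp' h1, av_down hp' h2⟩, ?_⟩
    rintro ρ rfl ⟨f, hf⟩
    refine c3 i ⟨_, emb_comp hf hp, fun x => ?_⟩
    have := Finset.orderEmbOfFin_mem (Finset.univ.filter (χ · = i)) rfl (f x)
    exact (Finset.mem_filter.mp this).2
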